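/- arXiv:2403.03749 — 3 statements merged into one kernel-verified Lean document; each statement's English description precedes it below -/
import Mathlib

section
/- Let κ ∈ ℂ with κ not a positive integer. Then for every z ∈ ℂ the series Σ_{ℓ=0}^∞ (−1)^ℓ (Γ(ℓ+1−κ)/(Γ(1−κ)·(2ℓ)!)) · M_{κ,ℓ+1/2}(z) converges, and its sum equals z · e^{-z/2}. -/
open scoped BigOperators
open MeasureTheory

noncomputable section

/-- Ascending Pochhammer symbol `(a)_n = a (a+1) ⋯ (a+n-1)`. -/
def aP (n : ℕ) (a : ℂ) : ℂ := (ascPochhammer ℂ n).eval a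

/-- The Whittaker function `M_{κ, ℓ+1/2}` as an entire function of `z`:
`M_{κ,ℓ+1/2}(z) = e^{-z/2} z^{ℓ+1} ∑_{n} ((ℓ+1-κ)_n / ((2ℓ+2)_n n!)) z^n`. -/
def whittakerM (κ : ℂ) (ℓ : ℕ) (z : ℂ) : ℂ :=
  Complex.exp (-z / 2) * z ^ (ℓ + 1) *
    ∑' n : ℕ, aP n ((ℓ : ℂ) + 1 - κ) / (aP n (2 * (ℓ : ℂ) + 2) * (n.factorial : ℂ)) * z ^ n


theorem aP_succ (n : ℕ) (a : ℂ) : aP (n + 1) a = aP n a * (a + n) :=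
  ascPochhammer_succ_eval n a

theorem aP_zero (a : ℂ) : aP 0 a = 1 := by simp [aP]

theorem aP_add (m n : ℕ) (a : ℂ) : aP (m + n) a = aP m a * aP n (m + a) := by
  induction n with
  | zero => simp [aP_zero]
  | succ n ih =>
    rw [← Nat.add_assoc, aP_succ, ih, aP_succ]
    push_cast
    ring

theorem factorial_mul_aP (m n : ℕ) :
    (m.factorial : ℂ) * aP n ((m : ℂ) + 1) = ((m + n).factorial : ℂ) := by
  induction n with
  | zero => simp [aP_zero]
  | succ n ih =>
    rw [aP_succ, ← mul_assoc, ih, ← Nat.add_assoc, Nat.factorial_succ]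
    push_cast
    ring

theorem Gamma_nat_add (a : ℂ) (ha : ∀ m : ℕ, a ≠ -m) (n : ℕ) :
    Complex.Gamma (n + a) = Complex.Gamma a * aP n a := by
  induction n with
  | zero => simp [aP_zero]
  | succ n ih =>
    have h : (n : ℂ) + a ≠ 0 := fun h => ha n (by linear_combination h)
    have e : ((n + 1 : ℕ) : ℂ) + a = (n + a) + 1 := by push_cast; ring
    rw [e, Complex.Gamma_add_one _ h, ih, aP_succ]
    ring

/-- The weight `(2ℓ+1) / ((2ℓ+n+1)! n!)` attached to the pair `(ℓ, n)`. -/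
def pairWeight (p : ℕ × ℕ) : ℝ :=
  (2 * (p.1 : ℝ) + 1) / (((2 * p.1 + p.2 + 1).factorial : ℝ) * (p.2.factorial : ℝ))

theorem pairWeight_nonneg (p : ℕ × ℕ) : 0 ≤ pairWeight p := by
  unfold pairWeight
  positivity

theorem sum_range_pairWeight (L m : ℕ) :
    ∑ l ∈ Finset.range L, pairWeight (l, L + m - l) =
      1 / ((L + m).factorial : ℝ) ^ 2 -
        1 / (((2 * L + m).factorial : ℝ) * (m.factorial : ℝ)) := by
  induction L generalizing m with
  | zero => simp [sq]
  | succ L ih =>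
    have h := ih (m + 1)
    have e : L + (m + 1) = L + 1 + m := by ring
    rw [e] at h
    rw [Finset.sum_range_succ, h, show L + 1 + m - L = m + 1 by omega, pairWeight]
    simp only [show 2 * L + (m + 1) = 2 * L + m + 1 by ring,
      show 2 * (L + 1) + m = 2 * L + m + 1 + 1 by ring, Nat.factorial_succ]
    push_cast
    field_simp
    ring

theorem sum_antidiagonal_pairWeight (N : ℕ) :
    ∑ p ∈ Finset.HasAntidiagonal.antidiagonal N, pairWeight p = 1 / (N.factorial : ℝ) ^ 2 := by
  have h := sum_range_pairWeight N 0
  rw [Finset.Nat.sum_antidiagonal_eq_sum_range_succ_mk, Finset.sum_range_succ]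
  simp only [Nat.add_zero] at h
  rw [h, pairWeight]
  simp only [Nat.sub_self, Nat.add_zero, Nat.factorial_succ]
  push_cast
  field_simp
  ring

theorem sum_range_alternating_pairWeight (L m : ℕ) :
    ((L + m : ℕ) : ℝ) * ∑ l ∈ Finset.range L, (-1) ^ l * pairWeight (l, L + m - l) =
      -((-1) ^ L * L / (((2 * L + m).factorial : ℝ) * (m.factorial : ℝ))) := by
  induction L generalizing m with
  | zero => simp
  | succ L ih =>
    have h := ih (m + 1)
    have e : L + (m + 1) = L + 1 + m := by ring
    rw [e] at h
    rw [Finset.sum_range_succ, mul_add, h, show L + 1 + m - L = m + 1 by omega, pairWeight]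
    simp only [show 2 * L + (m + 1) = 2 * L + m + 1 by ring,
      show 2 * (L + 1) + m = 2 * L + m + 1 + 1 by ring, Nat.factorial_succ]
    push_cast
    field_simp
    ring

theorem sum_antidiagonal_alternating_pairWeight (N : ℕ) :
    ∑ p ∈ Finset.HasAntidiagonal.antidiagonal N, (-1) ^ p.1 * pairWeight p = if N = 0 then 1 else 0 := by
  split_ifs with hN
  · subst hN
    simp [pairWeight]
  · have hN' : (N : ℝ) ≠ 0 := by exact_mod_cast hN
    have h := sum_range_alternating_pairWeight N 0
    simp only [Nat.add_zero] at h
    rw [Finset.Nat.sum_antidiagonal_eq_sum_range_succ_mk, Finset.sum_range_succ]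
    apply mul_left_cancel₀ hN'
    rw [mul_add, h, pairWeight]
    simp only [Nat.sub_self, Nat.add_zero, Nat.factorial_succ]
    push_cast
    field_simp
    ring

theorem summable_aP_mul_pow_div_factorial_sq (a z : ℂ) :
    Summable fun N : ℕ => ‖aP N a * z ^ N‖ * (1 / (N.factorial : ℝ) ^ 2) := by
  have hlim : Filter.Tendsto (fun N : ℕ => (‖a‖ + 1) * ‖z‖ * (1 / ((N : ℝ) + 1)))
      Filter.atTop (nhds 0) := by
    simpa using tendsto_one_div_add_atTop_nhds_zero_nat.const_mul ((‖a‖ + 1) * ‖z‖)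
  refine summable_of_ratio_norm_eventually_le (r := 1 / 2) (by norm_num) ?_
  filter_upwards [hlim.eventually_le_const (show (0 : ℝ) < 1 / 2 by norm_num)] with N hN
  have hpos : (0 : ℝ) < (N : ℝ) + 1 := by positivity
  have hb : ‖a + N‖ ≤ (‖a‖ + 1) * ((N : ℝ) + 1) := by
    have h := norm_add_le a (N : ℂ)
    rw [Complex.norm_natCast] at h
    nlinarith [norm_nonneg a, mul_nonneg (norm_nonneg a) (Nat.cast_nonneg (α := ℝ) N)]
  have hc : ‖a + N‖ * ‖z‖ / ((N : ℝ) + 1) ^ 2 ≤ 1 / 2 := by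
    refine le_trans ?_ hN
    calc ‖a + N‖ * ‖z‖ / ((N : ℝ) + 1) ^ 2
        ≤ (‖a‖ + 1) * ((N : ℝ) + 1) * ‖z‖ / ((N : ℝ) + 1) ^ 2 := by gcongr
      _ = _ := by field_simp
  rw [Real.norm_of_nonneg (by positivity), Real.norm_of_nonneg (by positivity)]
  calc ‖aP (N + 1) a * z ^ (N + 1)‖ * (1 / ((N + 1).factorial : ℝ) ^ 2)
      = (‖a + N‖ * ‖z‖ / ((N : ℝ) + 1) ^ 2) *
          (‖aP N a * z ^ N‖ * (1 / (N.factorial : ℝ) ^ 2)) := by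
        rw [aP_succ, pow_succ, Nat.factorial_succ]
        push_cast
        simp only [norm_mul]
        field_simp
    _ ≤ _ := by gcongr

/-- The `(ℓ, n)` term of the double series obtained by expanding each Whittaker function. -/
def pairTerm (a z : ℂ) (p : ℕ × ℕ) : ℂ :=
  aP (p.1 + p.2) a * z ^ (p.1 + p.2) * (((-1) ^ p.1 * pairWeight p : ℝ) : ℂ)

theorem norm_pairTerm (a z : ℂ) (p : ℕ × ℕ) :
    ‖pairTerm a z p‖ = ‖aP (p.1 + p.2) a * z ^ (p.1 + p.2)‖ * pairWeight p := by
  rw [pairTerm, norm_mul, Complex.norm_real, norm_mul ((-1 : ℝ) ^ p.1), norm_pow (-1 : ℝ),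
    norm_neg, norm_one, one_pow, one_mul, Real.norm_of_nonneg (pairWeight_nonneg p)]

theorem sum_antidiagonal_norm_pairTerm (a z : ℂ) (N : ℕ) :
    ∑ p ∈ Finset.HasAntidiagonal.antidiagonal N, ‖pairTerm a z p‖ =
      ‖aP N a * z ^ N‖ * (1 / (N.factorial : ℝ) ^ 2) := by
  rw [← sum_antidiagonal_pairWeight, Finset.mul_sum]
  refine Finset.sum_congr rfl fun p hp => ?_
  rw [norm_pairTerm, Finset.HasAntidiagonal.mem_antidiagonal.mp hp]

theorem sum_antidiagonal_pairTerm (a z : ℂ) (N : ℕ) :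
    ∑ p ∈ Finset.HasAntidiagonal.antidiagonal N, pairTerm a z p = if N = 0 then 1 else 0 := by
  have h : ∑ p ∈ Finset.HasAntidiagonal.antidiagonal N, pairTerm a z p =
      aP N a * z ^ N * ((∑ p ∈ Finset.HasAntidiagonal.antidiagonal N, (-1) ^ p.1 * pairWeight p : ℝ) : ℂ) := by
    rw [Complex.ofReal_sum, Finset.mul_sum]
    refine Finset.sum_congr rfl fun p hp => ?_
    rw [pairTerm, Finset.HasAntidiagonal.mem_antidiagonal.mp hp]
  rw [h, sum_antidiagonal_alternating_pairWeight]
  split_ifs with hN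
  · subst hN
    simp [aP_zero]
  · simp

theorem summable_pairTerm (a z : ℂ) : Summable (pairTerm a z) := by
  refine Summable.of_norm ?_
  rw [← Finset.HasAntidiagonal.sigmaAntidiagonalEquivProd.summable_iff]
  refine (summable_sigma_of_nonneg fun _ => norm_nonneg _).mpr
    ⟨fun N => (hasSum_fintype _).summable, ?_⟩
  refine (summable_aP_mul_pow_div_factorial_sq a z).congr fun N => ?_
  rw [tsum_fintype, ← sum_antidiagonal_norm_pairTerm, ← Finset.sum_coe_sort]
  rfl

theorem hasSum_pairTerm (a z : ℂ) : HasSum (pairTerm a z) 1 := by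
  have hs := summable_pairTerm a z
  have hσ := (Finset.HasAntidiagonal.sigmaAntidiagonalEquivProd.hasSum_iff.mpr hs.hasSum).sigma
    (g := fun N : ℕ => if N = 0 then (1 : ℂ) else 0) fun N => by
      rw [← sum_antidiagonal_pairTerm a z N, ← Finset.sum_coe_sort]
      exact hasSum_fintype _
  rw [← hσ.unique (hasSum_ite_eq 0 (1 : ℂ))]
  exact hs.hasSum

theorem pairTerm_eq (a z : ℂ) (ℓ n : ℕ) :
    pairTerm a z (ℓ, n) = (-1) ^ ℓ * (aP ℓ a / ((2 * ℓ).factorial : ℂ)) * z ^ ℓ *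
      (aP n (ℓ + a) / (aP n (2 * (ℓ : ℂ) + 2) * (n.factorial : ℂ)) * z ^ n) := by
  have h := factorial_mul_aP (2 * ℓ + 1) n
  have e : ((2 * ℓ + 1 : ℕ) : ℂ) + 1 = 2 * (ℓ : ℂ) + 2 := by push_cast; ring
  rw [e, Nat.factorial_succ, show 2 * ℓ + 1 + n = 2 * ℓ + n + 1 by ring] at h
  have h2 : ((2 * ℓ + n + 1).factorial : ℂ) ≠ 0 := by exact_mod_cast Nat.factorial_ne_zero _
  have h3 : ((2 * ℓ).factorial : ℂ) ≠ 0 := by exact_mod_cast Nat.factorial_ne_zero _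
  have h4 : (n.factorial : ℂ) ≠ 0 := by exact_mod_cast Nat.factorial_ne_zero _
  have h5 : aP n (2 * (ℓ : ℂ) + 2) ≠ 0 := by
    intro h0
    rw [h0, mul_zero] at h
    exact h2 h.symm
  simp only [pairTerm, pairWeight, aP_add]
  push_cast at h ⊢
  rw [← h] at h2 ⊢
  have h6 : (2 * (ℓ : ℂ) + 1) ≠ 0 := by
    intro h0
    simp [h0] at h2
  generalize aP n (2 * (ℓ : ℂ) + 2) = P at h5 ⊢
  generalize 2 * (ℓ : ℂ) + 1 = Q at h6 ⊢
  field_simp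
  ring

/-- A summation formula for the Whittaker functions `M_{κ,ℓ+1/2}`. -/
theorem whittakerM_summation (κ : ℂ) (hκ : ∀ n : ℕ, κ ≠ (n : ℂ) + 1) (z : ℂ) :
    HasSum
      (fun ℓ : ℕ =>
        (-1) ^ ℓ *
          (Complex.Gamma ((ℓ : ℂ) + 1 - κ) /
            (Complex.Gamma (1 - κ) * ((2 * ℓ).factorial : ℂ))) *
          whittakerM κ ℓ z)
      (z * Complex.exp (-z / 2)) := by
  have ha : ∀ m : ℕ, 1 - κ ≠ -m := fun m h => hκ m (by linear_combination -h)
  have hΓ : Complex.Gamma (1 - κ) ≠ 0 := Complex.Gamma_ne_zero ha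
  have hs := summable_pairTerm (1 - κ) z
  have hsum := ((hasSum_pairTerm (1 - κ) z).prod_fiberwise
    fun ℓ => (hs.prod_factor ℓ).hasSum).mul_left (z * Complex.exp (-z / 2))
  rw [mul_one] at hsum
  refine hsum.congr_fun fun ℓ => ?_
  simp only [pairTerm_eq, tsum_mul_left]
  rw [whittakerM, add_sub_assoc, Gamma_nat_add _ ha, mul_div_mul_left _ _ hΓ]
  ring
end
end

section
/- Let n ≥ 1 be an integer, let 0 < r₀ < r be real numbers and let γ ∈ ℝ. Set R := √(r² + r₀² − 2 r r₀ cos γ), x := r + r₀ + R and y := r + r₀ − R. Then Σ_{ℓ=0}^{n-1} ((2ℓ+1)·(n−ℓ−1)!/(n+ℓ)!) · (r r₀)^ℓ · L_{n−ℓ−1}^{2ℓ+1}(r) · L_{n−ℓ−1}^{2ℓ+1}(r₀) · P_ℓ(cos γ) = (1/(2R)) · ( x · L_{n−1}^1(x/2) · L_n(y/2) − y · L_{n−1}^1(y/2) · L_n(x/2) ). -/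
open scoped BigOperators

noncomputable section

/-- The generalized Laguerre polynomial `L_n^α(x) = ∑_{k=0}^n (-1)^k binom(n+α, n-k) x^k / k!`. -/
def laguerreL (α n : ℕ) (x : ℝ) : ℝ :=
  ∑ k ∈ Finset.range (n + 1),
    (-1) ^ k * ((n + α).choose (n - k) : ℝ) * x ^ k / (k.factorial : ℝ)

/-- The Legendre polynomial `P_ℓ`. -/
def legendreP (ℓ : ℕ) (x : ℝ) : ℝ :=
  (2 ^ ℓ : ℝ)⁻¹ * ∑ k ∈ Finset.range (ℓ / 2 + 1),
    (-1) ^ k * (ℓ.choose k : ℝ) * ((2 * ℓ - 2 * k).choose ℓ : ℝ) * x ^ (ℓ - 2 * k)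

section

open Finset

/-- The Laguerre sum may be extended over any longer range. -/
lemma laguerreL_eq_sum_range (α n M : ℕ) (h : n < M) (x : ℝ) :
    laguerreL α n x =
      ∑ k ∈ range M, (-1) ^ k * ((n + α).choose (α + k) : ℝ) * x ^ k / (k.factorial : ℝ) := by
  unfold laguerreL
  rw [← sum_subset (range_mono (show n + 1 ≤ M from h))]
  · refine sum_congr rfl fun k hk => ?_
    have hk : k ≤ n := by simpa [Nat.lt_succ_iff] using hk
    rw [Nat.choose_symm_of_eq_add (show n + α = (n - k) + (α + k) by omega)]
  · intro k _ hk
    have hk : n < k := by simpa using hk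
    rw [Nat.choose_eq_zero_of_lt (show n + α < α + k by omega)]
    simp

lemma laguerreL_zero_right (α : ℕ) (x : ℝ) : laguerreL α 0 x = 1 := by
  simp [laguerreL]

lemma laguerreL_succ_succ (α n : ℕ) (x : ℝ) :
    laguerreL (α + 1) (n + 1) x = laguerreL (α + 1) n x + laguerreL α (n + 1) x := by
  rw [laguerreL_eq_sum_range _ _ (n + 2) (by omega), laguerreL_eq_sum_range _ n (n + 2) (by omega),
    laguerreL_eq_sum_range _ _ (n + 2) (by omega), ← sum_add_distrib]
  refine sum_congr rfl fun k _ => ?_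
  rw [show n + 1 + (α + 1) = (n + α + 1) + 1 by ring, show α + 1 + k = (α + k) + 1 by ring,
    Nat.choose_succ_succ, show n + (α + 1) = n + α + 1 by ring,
    show n + 1 + α = n + α + 1 by ring]
  push_cast
  ring

lemma sum_range_laguerreL (α n : ℕ) (x : ℝ) :
    ∑ m ∈ range (n + 1), laguerreL α m x = laguerreL (α + 1) n x := by
  induction n with
  | zero => simp [laguerreL_zero_right]
  | succ n ih => rw [sum_range_succ, ih, laguerreL_succ_succ]

lemma mul_laguerreL_one (n : ℕ) (x : ℝ) :
    x * laguerreL 1 n x = (n + 1) * (laguerreL 0 n x - laguerreL 0 (n + 1) x) := by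
  have hsub : laguerreL 0 n x - laguerreL 0 (n + 1) x = ∑ k ∈ range (n + 1),
      (-1) ^ k * (n.choose k : ℝ) * x ^ (k + 1) / ((k + 1).factorial : ℝ) := by
    rw [laguerreL_eq_sum_range 0 n (n + 2) (by omega),
      laguerreL_eq_sum_range 0 (n + 1) (n + 2) (by omega), ← sum_sub_distrib, sum_range_succ']
    simp only [add_zero, zero_add, Nat.choose_zero_right, sub_self]
    refine sum_congr rfl fun k _ => ?_
    rw [Nat.choose_succ_succ n k]
    push_cast
    ring
  rw [hsub, laguerreL_eq_sum_range 1 n (n + 1) (by omega), mul_sum, mul_sum]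
  refine sum_congr rfl fun k _ => ?_
  have h2 : ((n : ℝ) + 1) * n.choose k = (n + 1).choose (k + 1) * (k + 1) := by
    exact_mod_cast Nat.add_one_mul_choose_eq n k
  have h3 : (k.factorial : ℝ) ≠ 0 := by positivity
  rw [add_comm 1 k, Nat.factorial_succ]
  push_cast
  field_simp
  linear_combination (-x ^ (k + 1)) * h2

/-- Christoffel–Darboux formula for the Laguerre polynomials. -/
lemma laguerreL_christoffel_darboux (n : ℕ) (u v : ℝ) :
    (u - v) * ∑ k ∈ range (n + 1), laguerreL 0 k u * laguerreL 0 k v =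
      u * laguerreL 1 n u * laguerreL 0 (n + 1) v -
        v * laguerreL 1 n v * laguerreL 0 (n + 1) u := by
  have key : ∀ (n : ℕ) (u v : ℝ),
      u * laguerreL 1 n u * laguerreL 0 (n + 1) v - v * laguerreL 1 n v * laguerreL 0 (n + 1) u =
      u * laguerreL 1 n u * laguerreL 0 n v - v * laguerreL 1 n v * laguerreL 0 n u := by
    intro n u v
    rw [mul_laguerreL_one, mul_laguerreL_one]
    ring
  induction n with
  | zero =>
    rw [key]
    simp [laguerreL_zero_right]
  | succ n ih =>
    rw [key, sum_range_succ, mul_add, ih, laguerreL_succ_succ 0 n u, laguerreL_succ_succ 0 n v]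
    ring

/-- Vandermonde's identity as a sum over a range. -/
lemma add_choose_eq_sum_range (N k b c : ℕ) (h : k ≤ b) :
    (N + k).choose (c + b) = ∑ i ∈ range (b + 1), k.choose i * N.choose (c + (b - i)) := by
  rw [add_comm N k, Nat.add_choose_eq,
    Nat.sum_antidiagonal_eq_sum_range_succ (fun i m => k.choose i * N.choose m),
    ← sum_subset (range_mono (show b + 1 ≤ (c + b).succ by omega))]
  · refine sum_congr rfl fun i hi => ?_
    have hi : i ≤ b := by simpa [Nat.lt_succ_iff] using hi
    rw [Nat.add_sub_assoc hi]
  · intro i _ hi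
    have hi : b < i := by simpa using hi
    simp [Nat.choose_eq_zero_of_lt (show k < i by omega)]

lemma sum_choose_mul_choose_mul_choose (α a b i : ℕ) (hi : i ≤ b) :
    ∑ k ∈ range (b + 1), a.choose k * (b + α).choose (α + k) * k.choose i =
      a.choose i * (α + a + (b - i)).choose (b - i) := by
  obtain ⟨d, rfl⟩ := Nat.exists_eq_add_of_le hi
  rcases lt_or_ge a i with ha | ha
  · rw [Nat.choose_eq_zero_of_lt ha, zero_mul]
    refine sum_eq_zero fun k _ => ?_
    rcases lt_or_ge a k with hk | hk
    · simp [Nat.choose_eq_zero_of_lt hk]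
    · simp [Nat.choose_eq_zero_of_lt (show k < i by omega)]
  obtain ⟨e, rfl⟩ := Nat.exists_eq_add_of_le ha
  rw [add_assoc i d 1, sum_range_add, sum_eq_zero, zero_add, Nat.add_sub_cancel_left,
    show α + (i + e) + d = e + (i + d + α) by ring, Nat.add_choose_eq e,
    Nat.sum_antidiagonal_eq_sum_range_succ (fun p q => e.choose p * (i + d + α).choose q), mul_sum]
  · refine sum_congr rfl fun k hk => ?_
    have hk : k ≤ d := by simpa [Nat.lt_succ_iff] using hk
    rw [Nat.choose_symm_of_eq_add (show i + d + α = (α + (i + k)) + (d - k) by omega)]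
    have h := Nat.choose_mul (n := i + e) (k := i + k) (s := i) (by omega)
    rw [Nat.add_sub_cancel_left, Nat.add_sub_cancel_left] at h
    rw [mul_right_comm, h, mul_assoc]
  · intro k hk
    have hk : k < i := by simpa using hk
    simp [Nat.choose_eq_zero_of_lt hk]

/-- A form of the Pfaff–Saalschütz identity. -/
lemma choose_mul_choose_eq_sum (n α a b M : ℕ) (hb : b < M) :
    (n + α).choose (α + a) * n.choose b =
      ∑ k ∈ range M, a.choose k * (b + α).choose (α + k) * (n + α + k).choose (α + a + b) := by
  symm
  calc
    _ = ∑ k ∈ range (b + 1),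
        a.choose k * (b + α).choose (α + k) * (n + α + k).choose (α + a + b) := by
      symm
      refine sum_subset (range_mono (show b + 1 ≤ M from hb)) fun k _ hk => ?_
      have hk : b < k := by simpa using hk
      simp [Nat.choose_eq_zero_of_lt (show b + α < α + k by omega)]
    _ = ∑ k ∈ range (b + 1), ∑ i ∈ range (b + 1), a.choose k * (b + α).choose (α + k) *
        k.choose i * (n + α).choose (α + a + (b - i)) := by
      refine sum_congr rfl fun k hk => ?_
      have hk : k ≤ b := by simpa [Nat.lt_succ_iff] using hk
      rw [add_choose_eq_sum_range _ _ _ _ hk, mul_sum]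
      exact sum_congr rfl fun i _ => by ring
    _ = ∑ i ∈ range (b + 1), (n + α).choose (α + a) *
        (a.choose i * (n + α - (α + a)).choose (b - i)) := by
      rw [sum_comm]
      refine sum_congr rfl fun i hi => ?_
      have hi : i ≤ b := by simpa [Nat.lt_succ_iff] using hi
      have h := Nat.choose_mul (n := n + α) (k := α + a + (b - i)) (s := α + a) (by omega)
      rw [Nat.add_sub_cancel_left] at h
      rw [← sum_mul, sum_choose_mul_choose_mul_choose _ _ _ _ hi,
        ← Nat.choose_symm_add, mul_left_comm, ← h]
      ring
    _ = _ := by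
      rw [← mul_sum]
      rcases lt_or_ge n a with ha | ha
      · simp [Nat.choose_eq_zero_of_lt (show n + α < α + a by omega)]
      · congr 1
        rw [show n + α - (α + a) = n - a by omega]
        conv_rhs => rw [show n = a + (n - a) by omega]
        rw [Nat.add_choose_eq,
          Nat.sum_antidiagonal_eq_sum_range_succ (fun p q => a.choose p * (n - a).choose q)]

lemma sum_range_shift (M k : ℕ) (g : ℕ → ℝ) (hg : ∀ q, M ≤ q + k → g q = 0) :
    ∑ q ∈ range M, g q = ∑ b ∈ range M, if k ≤ b then g (b - k) else 0 := by
  rcases lt_or_ge M k with hM | hM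
  · rw [sum_eq_zero fun q _ => hg q (by omega), sum_eq_zero]
    intro b hb
    have hb : b < M := by simpa using hb
    rw [if_neg (by omega)]
  · obtain ⟨d, rfl⟩ := Nat.exists_eq_add_of_le hM
    rw [sum_range_add (fun b => if k ≤ b then g (b - k) else 0), add_comm k d, sum_range_add]
    have h1 : ∑ q ∈ range k, g (d + q) = 0 := sum_eq_zero fun q _ => hg _ (by omega)
    have h2 : ∑ b ∈ range k, (if k ≤ b then g (b - k) else 0) = 0 := by
      refine sum_eq_zero fun b hb => ?_
      have hb : b < k := by simpa using hb
      rw [if_neg (by omega)]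
    rw [h1, h2, add_zero, zero_add]
    exact sum_congr rfl fun q _ => by simp

/-- Double power series expansion of a Laguerre polynomial at a sum. -/
lemma laguerreL_add (β m M : ℕ) (h : m < M) (x y : ℝ) :
    laguerreL β m (x + y) = ∑ p ∈ range M, ∑ q ∈ range M,
      (-1) ^ (p + q) * ((m + β).choose (β + (p + q)) : ℝ) * x ^ p * y ^ q /
        (p.factorial * q.factorial) := by
  set f : ℕ → ℕ → ℝ := fun p q => (-1) ^ (p + q) * ((m + β).choose (β + (p + q)) : ℝ) *
    x ^ p * y ^ q / (p.factorial * q.factorial) with hf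
  trans ∑ i ∈ range M, ∑ p ∈ range (i + 1), f p (i - p)
  · rw [laguerreL_eq_sum_range β m M h]
    refine sum_congr rfl fun i _ => ?_
    rw [add_pow, mul_sum, sum_div]
    refine sum_congr rfl fun p hp => ?_
    have hp : p ≤ i := by simpa [Nat.lt_succ_iff] using hp
    simp only [hf]
    rw [Nat.add_sub_cancel' hp, Nat.cast_choose ℝ hp]
    have : (i.factorial : ℝ) ≠ 0 := by positivity
    field_simp
  · rw [sum_range_diag_flip]
    refine sum_congr rfl fun p _ => sum_subset (range_mono (Nat.sub_le _ _)) fun q _ hq => ?_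
    have hq : M ≤ q + p := by simpa using hq
    simp only [hf]
    rw [Nat.choose_eq_zero_of_lt (show m + β < β + (p + q) by omega)]
    simp

/-- Bailey's product formula for the Laguerre polynomials. -/
lemma laguerreL_mul_laguerreL (α n : ℕ) (x y : ℝ) :
    laguerreL α n x * laguerreL α n y =
      ((n + α).factorial : ℝ) / n.factorial * ∑ k ∈ range (n + 1),
        (x * y) ^ k / (k.factorial * (k + α).factorial) * laguerreL (α + 2 * k) (n - k) (x + y) := by
  have hexp : ∀ k ∈ range (n + 1), laguerreL (α + 2 * k) (n - k) (x + y) =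
      ∑ a ∈ range (n + 1), ∑ b ∈ range (n + 1), if k ≤ a then if k ≤ b then
        (-1) ^ (a + b) * ((n + α + k).choose (α + a + b) : ℝ) * x ^ (a - k) * y ^ (b - k) /
          ((a - k).factorial * (b - k).factorial) else 0 else 0 := by
    intro k hk
    have hk : k ≤ n := by simpa [Nat.lt_succ_iff] using hk
    rw [laguerreL_add _ _ (n + 1) (by omega), sum_range_shift _ k]
    · refine sum_congr rfl fun a _ => ?_
      split_ifs with ha
      · rw [sum_range_shift _ k]
        · refine sum_congr rfl fun b _ => ?_
          split_ifs with hb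
          · obtain ⟨p, rfl⟩ := Nat.exists_eq_add_of_le ha
            obtain ⟨q, rfl⟩ := Nat.exists_eq_add_of_le hb
            rw [Nat.add_sub_cancel_left, Nat.add_sub_cancel_left,
              show n - k + (α + 2 * k) = n + α + k by omega,
              show α + 2 * k + (p + q) = α + (k + p) + (k + q) by ring,
              show k + p + (k + q) = 2 * k + (p + q) by ring, pow_add _ (2 * k), pow_mul]
            simp
          · rfl
        · intro q hq
          rw [Nat.choose_eq_zero_of_lt (by omega)]
          simp
      · simp
    · intro p hp
      refine sum_eq_zero fun q _ => ?_
      rw [Nat.choose_eq_zero_of_lt (by omega)]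
      simp
  rw [sum_congr rfl fun k hk => by rw [hexp k hk]]
  simp only [mul_sum]
  rw [sum_comm]
  rw [laguerreL_eq_sum_range α n (n + 1) (by omega), laguerreL_eq_sum_range α n (n + 1) (by omega),
    sum_mul_sum]
  refine sum_congr rfl fun a _ => ?_
  rw [sum_comm]
  refine sum_congr rfl fun b hb => ?_
  have hbn : b ≤ n := by simpa [Nat.lt_succ_iff] using hb
  have hS : ((n + α).choose (α + a) : ℝ) * n.choose b = ∑ k ∈ range (n + 1),
      (a.choose k : ℝ) * (b + α).choose (α + k) * (n + α + k).choose (α + a + b) := by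
    exact_mod_cast choose_mul_choose_eq_sum n α a b (n + 1) (by omega)
  trans ((-1) ^ (a + b) * x ^ a * y ^ b * (n + α).factorial /
      (a.factorial * n.factorial * (b + α).factorial)) *
        (((n + α).choose (α + a) : ℝ) * n.choose b)
  · rw [Nat.cast_choose ℝ hbn, Nat.cast_choose ℝ (show α + b ≤ n + α by omega),
      show n + α - (α + b) = n - b by omega, add_comm b α, pow_add]
    have : (n.factorial : ℝ) ≠ 0 := by positivity
    field_simp
  · rw [hS, mul_sum]
    refine sum_congr rfl fun k _ => ?_
    split_ifs with ha hb'
    · rw [Nat.cast_choose ℝ ha, Nat.cast_choose ℝ (show α + k ≤ b + α by omega),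
        show b + α - (α + k) = b - k by omega, add_comm k α]
      obtain ⟨p, rfl⟩ := Nat.exists_eq_add_of_le ha
      obtain ⟨q, rfl⟩ := Nat.exists_eq_add_of_le hb'
      rw [Nat.add_sub_cancel_left, Nat.add_sub_cancel_left, pow_add x, pow_add y, mul_pow]
      have h1 : ((k + p).factorial : ℝ) ≠ 0 := by positivity
      have h2 : ((k + q + α).factorial : ℝ) ≠ 0 := by positivity
      field_simp
    · rw [Nat.choose_eq_zero_of_lt (show b + α < α + k by omega)]
      simp
    · rw [Nat.choose_eq_zero_of_lt (show a < k by omega)]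
      simp

lemma choose_mul_choose_legendre_eq_zero (ℓ k : ℕ) (h : ℓ < 2 * k) :
    ((ℓ.choose k : ℕ) : ℝ) * ((2 * ℓ - 2 * k).choose ℓ : ℕ) = 0 := by
  rcases lt_or_ge ℓ k with h0 | h0
  · simp [Nat.choose_eq_zero_of_lt h0]
  · simp [Nat.choose_eq_zero_of_lt (show 2 * ℓ - 2 * k < ℓ by omega)]

lemma legendreP_eq_sum_range (ℓ M : ℕ) (h : ℓ / 2 < M) (x : ℝ) :
    legendreP ℓ x = ∑ k ∈ range M, (2 ^ ℓ : ℝ)⁻¹ *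
      ((-1) ^ k * ((ℓ.choose k : ℝ) * ((2 * ℓ - 2 * k).choose ℓ : ℝ)) * x ^ (ℓ - 2 * k)) := by
  unfold legendreP
  simp only [← mul_assoc ((-1 : ℝ) ^ _)]
  rw [← mul_sum, ← sum_subset (range_mono (show ℓ / 2 + 1 ≤ M from h))]
  intro k _ hk
  have hk : ℓ / 2 < k := by simpa using hk
  rw [mul_assoc ((-1 : ℝ) ^ k), choose_mul_choose_legendre_eq_zero ℓ k (by omega)]
  simp

lemma choose_mul_choose_legendre (i k : ℕ) :
    (((i + 2 * k).choose k : ℕ) : ℝ) * ((2 * (i + 2 * k) - 2 * k).choose (i + 2 * k) : ℕ) =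
      (2 * i + 2 * k).factorial / (k.factorial * (i + k).factorial * i.factorial) := by
  rw [Nat.cast_choose ℝ (show k ≤ i + 2 * k by omega),
    Nat.cast_choose ℝ (show i + 2 * k ≤ 2 * (i + 2 * k) - 2 * k by omega),
    show i + 2 * k - k = i + k by omega, show 2 * (i + 2 * k) - 2 * k - (i + 2 * k) = i by omega,
    show 2 * (i + 2 * k) - 2 * k = 2 * i + 2 * k by omega]
  have : ((i + 2 * k).factorial : ℝ) ≠ 0 := by positivity
  field_simp

lemma legendreP_zero (x : ℝ) : legendreP 0 x = 1 := by
  simp [legendreP]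

lemma legendreP_one (x : ℝ) : legendreP 1 x = x := by
  simp [legendreP]

lemma legendreP_add_two (ℓ : ℕ) (x : ℝ) :
    ((ℓ : ℝ) + 2) * legendreP (ℓ + 2) x =
      (2 * ℓ + 3) * x * legendreP (ℓ + 1) x - (ℓ + 1) * legendreP ℓ x := by
  rw [legendreP_eq_sum_range (ℓ + 2) (ℓ + 2) (by omega),
    legendreP_eq_sum_range (ℓ + 1) (ℓ + 2) (by omega),
    legendreP_eq_sum_range ℓ (ℓ + 1) (by omega),
    sum_range_succ', sum_range_succ' _ (ℓ + 1), mul_add ((ℓ : ℝ) + 2),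
    mul_add ((2 * (ℓ : ℝ) + 3) * x), mul_sum, mul_sum, mul_sum,
    add_sub_right_comm, ← sum_sub_distrib]
  congr 1
  · refine sum_congr rfl fun k _ => ?_
    rcases lt_trichotomy ℓ (2 * k) with h | h | h
    · rw [choose_mul_choose_legendre_eq_zero (ℓ + 2) (k + 1) (by omega),
        choose_mul_choose_legendre_eq_zero (ℓ + 1) (k + 1) (by omega),
        choose_mul_choose_legendre_eq_zero ℓ k h]
      simp
    · subst h
      have h1 := choose_mul_choose_legendre 0 (k + 1)
      have h2 := choose_mul_choose_legendre 0 k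
      rw [zero_add, zero_add, show 2 * (k + 1) = 2 * k + 2 by ring] at h1
      rw [zero_add] at h2
      rw [choose_mul_choose_legendre_eq_zero (2 * k + 1) (k + 1) (by omega),
        show 2 * (k + 1) = 2 * k + 2 by ring, h1, h2, mul_zero, zero_add, zero_add,
        Nat.sub_self, Nat.sub_self, Nat.factorial_succ (2 * k + 1), Nat.factorial_succ (2 * k),
        Nat.factorial_succ k]
      have h3 : (k.factorial : ℝ) ≠ 0 := by positivity
      have h4 : (k : ℝ) + 1 ≠ 0 := by positivity
      push_cast
      field_simp
      ring
    · obtain ⟨i, rfl⟩ := Nat.exists_eq_add_of_lt h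
      have h1 := choose_mul_choose_legendre (i + 1) (k + 1)
      have h2 := choose_mul_choose_legendre i (k + 1)
      have h3 := choose_mul_choose_legendre (i + 1) k
      rw [show i + 1 + 2 * (k + 1) = 2 * k + i + 1 + 2 by ring,
        show 2 * (i + 1) + 2 * (k + 1) = 2 * i + 2 * k + 2 + 1 + 1 by ring,
        show i + 1 + (k + 1) = i + k + 1 + 1 by ring] at h1
      rw [show i + 2 * (k + 1) = 2 * k + i + 1 + 1 by ring,
        show 2 * i + 2 * (k + 1) = 2 * i + 2 * k + 2 by ring, ← add_assoc i k 1] at h2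
      rw [show i + 1 + 2 * k = 2 * k + i + 1 by ring,
        show 2 * (i + 1) + 2 * k = 2 * i + 2 * k + 2 by ring, add_right_comm i 1 k] at h3
      rw [h1, h2, h3, show 2 * k + i + 1 + 2 - 2 * (k + 1) = i + 1 by omega,
        show 2 * k + i + 1 + 1 - 2 * (k + 1) = i by omega,
        show 2 * k + i + 1 - 2 * k = i + 1 by omega, Nat.factorial_succ (2 * i + 2 * k + 2 + 1),
        Nat.factorial_succ (2 * i + 2 * k + 2), Nat.factorial_succ (i + k + 1),
        Nat.factorial_succ k, Nat.factorial_succ i]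
      have h4 : (k.factorial : ℝ) ≠ 0 := by positivity
      have h5 : (i.factorial : ℝ) ≠ 0 := by positivity
      have h6 : ((i + k + 1).factorial : ℝ) ≠ 0 := by positivity
      have h7 : (k : ℝ) + 1 ≠ 0 := by positivity
      have h8 : (i : ℝ) + 1 ≠ 0 := by positivity
      have h9 : (i : ℝ) + k + 1 + 1 ≠ 0 := by positivity
      push_cast
      field_simp
      ring
  · have h : ((ℓ : ℝ) + 2) * (2 * (ℓ + 2)).choose (ℓ + 2) =
        2 * (2 * (ℓ + 1) + 1) * (2 * (ℓ + 1)).choose (ℓ + 1) := by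
      exact_mod_cast Nat.succ_mul_centralBinom_succ (ℓ + 1)
    simp only [pow_zero, Nat.choose_zero_right, Nat.cast_one, mul_zero, Nat.sub_zero, one_mul]
    rw [pow_succ (2 : ℝ) (ℓ + 1)]
    field_simp
    linear_combination x ^ (ℓ + 2) * h

lemma mul_legendreP (ℓ : ℕ) (x : ℝ) :
    (2 * ℓ + 1) * x * legendreP ℓ x =
      (ℓ + 1) * legendreP (ℓ + 1) x + ℓ * legendreP (ℓ - 1) x := by
  cases ℓ with
  | zero => simp [legendreP_zero, legendreP_one]
  | succ ℓ =>
    have := legendreP_add_two ℓ x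
    rw [Nat.add_sub_cancel]
    push_cast
    linear_combination -this

lemma choose_three_term (j ℓ : ℕ) :
    ((2 * j + 3 : ℕ) : ℝ) * ((2 * ℓ + 1) * (2 * j + 1).choose (j + ℓ + 1) +
      ℓ * (2 * j + 1).choose (j + ℓ) + (ℓ + 1) * (2 * j + 1).choose (j + ℓ + 2)) =
      (j + 1) * (2 * ℓ + 1) * (2 * j + 3).choose (j + ℓ + 2) := by
  have h1 : ((2 * j + 2).choose (j + ℓ + 1) : ℝ) =
      (2 * j + 1).choose (j + ℓ) + (2 * j + 1).choose (j + ℓ + 1) := by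
    exact_mod_cast Nat.choose_succ_succ _ _
  have h2 : ((2 * j + 2).choose (j + ℓ + 2) : ℝ) =
      (2 * j + 1).choose (j + ℓ + 1) + (2 * j + 1).choose (j + ℓ + 2) := by
    exact_mod_cast Nat.choose_succ_succ _ _
  have h3 : ((2 * j + 3).choose (j + ℓ + 2) : ℝ) =
      (2 * j + 2).choose (j + ℓ + 1) + (2 * j + 2).choose (j + ℓ + 2) := by
    exact_mod_cast Nat.choose_succ_succ _ _
  have h4 : (2 * (j : ℝ) + 3) * (2 * j + 2).choose (j + ℓ + 1) =
      (2 * j + 3).choose (j + ℓ + 2) * (j + ℓ + 2) := by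
    exact_mod_cast Nat.add_one_mul_choose_eq (2 * j + 2) (j + ℓ + 1)
  push_cast
  linear_combination (-(2 * j + 3) * ℓ) * h1 - (2 * j + 3) * (ℓ + 1) * h2 - h4 -
    (2 * j + 3) * (ℓ + 1) * h3

/-- Legendre expansion of `((1 + x) / 2) ^ j`. -/
lemma sum_choose_mul_legendreP (j : ℕ) (x : ℝ) :
    ∑ ℓ ∈ range (j + 1), (2 * ℓ + 1) * ((2 * j + 1).choose (j + ℓ + 1) : ℝ) * legendreP ℓ x =
      (2 * j + 1).factorial / (j.factorial : ℝ) ^ 2 * ((1 + x) / 2) ^ j := by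
  induction j with
  | zero => simp [legendreP_zero]
  | succ j ih =>
    set U : ℕ → ℝ := fun ℓ => ℓ * ((2 * j + 1).choose (j + ℓ) * legendreP ℓ x -
      (2 * j + 1).choose (j + ℓ + 1) * legendreP (ℓ - 1) x) with hU
    have hstep : (j + 1) * ∑ ℓ ∈ range (j + 2),
        (2 * ℓ + 1) * ((2 * j + 3).choose (j + ℓ + 2) : ℝ) * legendreP ℓ x =
        (2 * j + 3) * (1 + x) * ∑ ℓ ∈ range (j + 2),
          (2 * ℓ + 1) * ((2 * j + 1).choose (j + ℓ + 1) : ℝ) * legendreP ℓ x := by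
      have htel : ∑ ℓ ∈ range (j + 2), (U ℓ - U (ℓ + 1)) = 0 := by
        rw [sum_range_sub']
        simp only [hU]
        rw [Nat.choose_eq_zero_of_lt (show 2 * j + 1 < j + (j + 2) by omega),
          Nat.choose_eq_zero_of_lt (show 2 * j + 1 < j + (j + 2) + 1 by omega)]
        simp
      rw [← sub_eq_zero, mul_sum, mul_sum, ← sum_sub_distrib, ← mul_zero (2 * (j : ℝ) + 3), ← htel,
        mul_sum]
      refine sum_congr rfl fun ℓ _ => ?_
      have h1 := choose_three_term j ℓ
      have h2 := mul_legendreP ℓ x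
      simp only [hU, Nat.add_sub_cancel, ← add_assoc]
      push_cast at h1 ⊢
      linear_combination (-legendreP ℓ x) * h1 -
        (2 * j + 3) * ((2 * j + 1).choose (j + ℓ + 1) : ℝ) * h2
    rw [sum_range_succ (fun ℓ : ℕ => (2 * (ℓ : ℝ) + 1) * ((2 * j + 1).choose (j + ℓ + 1) : ℝ) *
        legendreP ℓ x) (j + 1),
      Nat.choose_eq_zero_of_lt (show 2 * j + 1 < j + (j + 1) + 1 by omega), ih] at hstep
    have hj : (j : ℝ) + 1 ≠ 0 := by positivity
    apply mul_left_cancel₀ hj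
    simp only [show ∀ ℓ, j + 1 + ℓ + 1 = j + ℓ + 2 by intro; ring,
      show 2 * (j + 1) + 1 = 2 * j + 3 by ring]
    rw [hstep, Nat.factorial_succ (2 * j + 2), Nat.factorial_succ (2 * j + 1),
      Nat.factorial_succ j]
    push_cast
    field_simp
    ring

lemma sum_legendreP (j : ℕ) (x : ℝ) :
    ∑ ℓ ∈ range (j + 1), (2 * ℓ + 1) * legendreP ℓ x /
      ((j - ℓ).factorial * (j + ℓ + 1).factorial) = ((1 + x) / 2) ^ j / (j.factorial : ℝ) ^ 2 := by
  have hj : ((2 * j + 1).factorial : ℝ) ≠ 0 := by positivity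
  apply mul_left_cancel₀ hj
  trans ∑ ℓ ∈ range (j + 1), (2 * ℓ + 1) * ((2 * j + 1).choose (j + ℓ + 1) : ℝ) * legendreP ℓ x
  · rw [mul_sum]
    refine sum_congr rfl fun ℓ hℓ => ?_
    have hℓ : ℓ ≤ j := by simpa [Nat.lt_succ_iff] using hℓ
    rw [Nat.cast_choose ℝ (show j + ℓ + 1 ≤ 2 * j + 1 by omega),
      show 2 * j + 1 - (j + ℓ + 1) = j - ℓ by omega]
    field_simp
  · rw [sum_choose_mul_legendreP]
    ring

lemma sum_laguerreL_legendreP (n : ℕ) (r s c u v : ℝ) (hs : u + v = r + s)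
    (hp : u * v = r * s * ((1 + c) / 2)) :
    ∑ ℓ ∈ range n,
        ((2 * ℓ + 1 : ℕ) : ℝ) * ((n - ℓ - 1).factorial : ℝ) / ((n + ℓ).factorial : ℝ) *
          (r * s) ^ ℓ * laguerreL (2 * ℓ + 1) (n - ℓ - 1) r * laguerreL (2 * ℓ + 1) (n - ℓ - 1) s *
          legendreP ℓ c =
      ∑ k ∈ range n, laguerreL 0 k u * laguerreL 0 k v := by
  have hR : ∑ k ∈ range n, laguerreL 0 k u * laguerreL 0 k v =
      ∑ j ∈ range n, (u * v) ^ j / (j.factorial : ℝ) ^ 2 *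
        laguerreL (2 * j + 1) (n - j - 1) (r + s) := by
    have := sum_range_diag_flip n (fun j m => (u * v) ^ j / (j.factorial : ℝ) ^ 2 *
        laguerreL (2 * j) m (r + s))
    convert this using 1
    · refine sum_congr rfl fun k _ => ?_
      rw [laguerreL_mul_laguerreL, hs, add_zero, div_self (by positivity), one_mul]
      refine sum_congr rfl fun j _ => ?_
      rw [add_zero, zero_add, sq]
    · refine sum_congr rfl fun j hj => ?_
      have hj : j < n := by simpa using hj
      rw [← mul_sum, ← sum_range_laguerreL, show n - j - 1 + 1 = n - j by omega]
  rw [hR]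
  trans ∑ j ∈ range n, ∑ ℓ ∈ range (j + 1), (2 * ℓ + 1) * legendreP ℓ c /
      ((j - ℓ).factorial * (j - ℓ + (2 * ℓ + 1)).factorial) * (r * s) ^ (ℓ + (j - ℓ)) *
        laguerreL (2 * (ℓ + (j - ℓ)) + 1) (n - (ℓ + (j - ℓ)) - 1) (r + s)
  · rw [sum_range_diag_flip n (fun ℓ k => (2 * ℓ + 1) * legendreP ℓ c /
      (k.factorial * (k + (2 * ℓ + 1)).factorial) * (r * s) ^ (ℓ + k) *
        laguerreL (2 * (ℓ + k) + 1) (n - (ℓ + k) - 1) (r + s))]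
    refine sum_congr rfl fun ℓ hℓ => ?_
    have hℓ : ℓ < n := by simpa using hℓ
    rw [mul_assoc (_ * _ ^ ℓ), laguerreL_mul_laguerreL, show n - ℓ - 1 + 1 = n - ℓ by omega,
      show n - ℓ - 1 + (2 * ℓ + 1) = n + ℓ by omega, mul_sum, mul_sum, sum_mul]
    refine sum_congr rfl fun k _ => ?_
    rw [show 2 * ℓ + 1 + 2 * k = 2 * (ℓ + k) + 1 by ring,
      show n - ℓ - 1 - k = n - (ℓ + k) - 1 by omega, pow_add]
    have h1 : ((n + ℓ).factorial : ℝ) ≠ 0 := by positivity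
    have h2 : ((n - ℓ - 1).factorial : ℝ) ≠ 0 := by positivity
    push_cast
    field_simp
  · refine sum_congr rfl fun j _ => ?_
    rw [hp, mul_pow, mul_div_assoc, ← sum_legendreP, mul_sum, sum_mul]
    refine sum_congr rfl fun ℓ hℓ => ?_
    have hℓ : ℓ ≤ j := by simpa [Nat.lt_succ_iff] using hℓ
    rw [Nat.add_sub_cancel' hℓ, show j - ℓ + (2 * ℓ + 1) = j + ℓ + 1 by omega]
    ring

end

/-- The addition formula for the Laguerre polynomials. -/
theorem laguerre_addition_formula (n : ℕ) (hn : 1 ≤ n) (r₀ r γ : ℝ)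
    (hr₀ : 0 < r₀) (hr : r₀ < r) (R x y : ℝ)
    (hR : R = Real.sqrt (r ^ 2 + r₀ ^ 2 - 2 * r * r₀ * Real.cos γ))
    (hx : x = r + r₀ + R) (hy : y = r + r₀ - R) :
    ∑ ℓ ∈ Finset.range n,
        ((2 * ℓ + 1 : ℕ) : ℝ) * ((n - ℓ - 1).factorial : ℝ) / ((n + ℓ).factorial : ℝ) *
          (r * r₀) ^ ℓ * laguerreL (2 * ℓ + 1) (n - ℓ - 1) r * laguerreL (2 * ℓ + 1) (n - ℓ - 1) r₀ *
          legendreP ℓ (Real.cos γ) =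
      (1 / (2 * R)) *
        (x * laguerreL 1 (n - 1) (x / 2) * laguerreL 0 n (y / 2) -
          y * laguerreL 1 (n - 1) (y / 2) * laguerreL 0 n (x / 2)) := by
  have hD : 0 < r ^ 2 + r₀ ^ 2 - 2 * r * r₀ * Real.cos γ := by
    nlinarith [Real.cos_le_one γ, mul_pos hr₀ (hr₀.trans hr), pow_pos (sub_pos.2 hr) 2]
  have hRpos : 0 < R := hR ▸ Real.sqrt_pos.2 hD
  have hRsq : R ^ 2 = r ^ 2 + r₀ ^ 2 - 2 * r * r₀ * Real.cos γ := by
    rw [hR, Real.sq_sqrt hD.le]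
  rw [sum_laguerreL_legendreP n r r₀ (Real.cos γ) (x / 2) (y / 2) (by rw [hx, hy]; ring)
    (by rw [hx, hy]; linear_combination (-1 / 4) * hRsq)]
  obtain ⟨m, rfl⟩ := Nat.exists_eq_add_of_le' hn
  have hxy : R = x / 2 - y / 2 := by rw [hx, hy]; ring
  have h := laguerreL_christoffel_darboux m (x / 2) (y / 2)
  rw [← hxy] at h
  rw [Nat.add_sub_cancel]
  field_simp
  linear_combination 2 * h
end
end

section
/- For every integer n ≥ 1, ∫_0^∞ e^{-r} · ( L_n(r) · L_{n-1}^1(r) − r · L_n(r) · L_{n-2}^2(r) + r · (L_{n-1}^1(r))² ) · r² dr = 2 n³, where for n = 1 the term L_{n-2}^2 = L_{-1}^2 is interpreted as 0. -/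
open scoped BigOperators
open MeasureTheory

noncomputable section

open Polynomial in
/-- The linear functional `X ^ k ↦ k!`, which is integration against `exp (-r)` on `(0, ∞)`. -/
def expMoment : ℝ[X] →ₗ[ℝ] ℝ :=
  Polynomial.lsum fun k => (k.factorial : ℝ) • LinearMap.id

namespace expMoment

open Polynomial

theorem monomial (k : ℕ) (a : ℝ) : expMoment (monomial k a) = k.factorial * a := by
  simp [expMoment, Polynomial.lsum_apply, Polynomial.sum_monomial_index]

theorem C_mul (a : ℝ) (p : ℝ[X]) : expMoment (C a * p) = a * expMoment p := by
  rw [← smul_eq_C_mul, map_smul, smul_eq_mul]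

theorem derivative (p : ℝ[X]) :
    expMoment (Polynomial.derivative p) = expMoment p - p.eval 0 := by
  induction p using Polynomial.induction_on' with
  | add p q hp hq => simp only [map_add, eval_add, hp, hq]; ring
  | monomial k a =>
    rw [derivative_monomial, monomial, monomial, eval_monomial]
    cases k with
    | zero => simp
    | succ k => simp [Nat.factorial_succ]; ring

theorem integrableOn_exp_neg_mul_pow (k : ℕ) :
    IntegrableOn (fun r : ℝ => Real.exp (-r) * r ^ k) (Set.Ioi 0) := by
  simpa using Real.GammaIntegral_convergent (s := (k : ℝ) + 1) (by positivity)

theorem integral_exp_neg_mul_pow (k : ℕ) :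
    ∫ r in Set.Ioi (0 : ℝ), Real.exp (-r) * r ^ k = k.factorial := by
  have h := Real.Gamma_eq_integral (s := (k : ℝ) + 1) (by positivity)
  rw [Real.Gamma_nat_eq_factorial] at h
  simpa using h.symm

theorem integrableOn_and_integral_eq (p : ℝ[X]) :
    IntegrableOn (fun r : ℝ => Real.exp (-r) * p.eval r) (Set.Ioi 0) ∧
      ∫ r in Set.Ioi (0 : ℝ), Real.exp (-r) * p.eval r = expMoment p := by
  induction p using Polynomial.induction_on' with
  | add p q hp hq =>
    simp only [eval_add, mul_add, map_add]
    exact ⟨hp.1.add hq.1, by rw [integral_add hp.1 hq.1, hp.2, hq.2]⟩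
  | monomial k a =>
    simp only [eval_monomial, mul_left_comm _ a, monomial]
    refine ⟨(integrableOn_exp_neg_mul_pow k).const_mul a, ?_⟩
    rw [integral_const_mul, integral_exp_neg_mul_pow, mul_comm]

section LaguerreEquation

variable {y : ℝ[X]} {ν : ℝ}

theorem X_pow_mul_sq (y : ℝ[X]) (k : ℕ) :
    expMoment (X ^ (k + 1) * y ^ 2) = (k + 1) * expMoment (X ^ k * y ^ 2) +
      2 * expMoment (X ^ (k + 1) * (y * Polynomial.derivative y)) := by
  have h := derivative (X ^ (k + 1) * y ^ 2)
  have e : Polynomial.derivative (X ^ (k + 1) * y ^ 2) = C ((k : ℝ) + 1) * (X ^ k * y ^ 2) +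
      C 2 * (X ^ (k + 1) * (y * Polynomial.derivative y)) := by
    simp [derivative_pow]; ring
  rw [e, map_add, C_mul, C_mul] at h
  simp at h
  linarith

theorem X_pow_mul_derivative_sq
    (ode : X * Polynomial.derivative (Polynomial.derivative y) =
      (X - 1) * Polynomial.derivative y - C ν * y) (k : ℕ) :
    expMoment (X ^ (k + 1) * Polynomial.derivative y ^ 2) = ν * expMoment (X ^ k * y ^ 2) -
      k * expMoment (X ^ k * (y * Polynomial.derivative y)) := by
  have h := derivative (X ^ (k + 1) * (y * Polynomial.derivative y))
  have e : Polynomial.derivative (X ^ (k + 1) * (y * Polynomial.derivative y)) =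
      C (k : ℝ) * (X ^ k * (y * Polynomial.derivative y)) +
      X ^ (k + 1) * Polynomial.derivative y ^ 2 +
      X ^ (k + 1) * (y * Polynomial.derivative y) - C ν * (X ^ k * y ^ 2) := by
    simp [derivative_pow]
    linear_combination X ^ k * y * ode
  rw [e, map_sub, map_add, map_add, C_mul, C_mul] at h
  simp at h
  linarith

theorem X_pow_mul_mul_derivative
    (ode : X * Polynomial.derivative (Polynomial.derivative y) =
      (X - 1) * Polynomial.derivative y - C ν * y) (k : ℕ) :
    2 * ν * expMoment (X ^ k * (y * Polynomial.derivative y)) =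
      (k - 1) * expMoment (X ^ k * Polynomial.derivative y ^ 2) +
      expMoment (X ^ (k + 1) * Polynomial.derivative y ^ 2) := by
  have h := derivative (X ^ (k + 1) * Polynomial.derivative y ^ 2)
  have e : Polynomial.derivative (X ^ (k + 1) * Polynomial.derivative y ^ 2) =
      C ((k : ℝ) - 1) * (X ^ k * Polynomial.derivative y ^ 2) +
      C 2 * (X ^ (k + 1) * Polynomial.derivative y ^ 2) -
      C (2 * ν) * (X ^ k * (y * Polynomial.derivative y)) := by
    simp [derivative_pow, map_ofNat C 2]
    linear_combination 2 * X ^ k * Polynomial.derivative y * ode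
  rw [e, map_sub, map_add, C_mul, C_mul, C_mul] at h
  simp at h
  linarith

end LaguerreEquation

end expMoment

namespace laguerreL

open Polynomial

/-- `laguerreL` as a polynomial. -/
def poly (α n : ℕ) : ℝ[X] :=
  ∑ k ∈ Finset.range (n + 1),
    monomial k ((-1) ^ k * ((n + α).choose (n - k) : ℝ) / (k.factorial : ℝ))

theorem eval_poly (α n : ℕ) (x : ℝ) : (poly α n).eval x = laguerreL α n x := by
  simp only [poly, laguerreL, eval_finsetSum, eval_monomial]
  exact Finset.sum_congr rfl fun k _ => by ring

theorem derivative_poly_zero (α : ℕ) : derivative (poly α 0) = 0 := by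
  simp [poly]

theorem derivative_poly_succ (α n : ℕ) : derivative (poly α (n + 1)) = -poly (α + 1) n := by
  rw [poly, poly, Finset.sum_range_succ', derivative_add, derivative_sum, ← Finset.sum_neg_distrib]
  simp only [derivative_monomial, ← monomial_neg]
  simp only [Nat.cast_zero, mul_zero, monomial_zero_right, add_zero]
  refine Finset.sum_congr rfl fun k _ => ?_
  have h : n + 1 + α = n + (α + 1) := by ring
  rw [h, Nat.add_sub_cancel, Nat.add_sub_add_right, Nat.factorial_succ]
  congr 1
  have := Nat.factorial_ne_zero k
  push_cast
  field_simp
  ring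

theorem coeff_poly_zero (n k : ℕ) :
    (poly 0 n).coeff k = (-1) ^ k * (n.choose k : ℝ) / (k.factorial : ℝ) := by
  simp only [poly, finsetSum_coeff, coeff_monomial, Finset.sum_ite_eq', Finset.mem_range,
    add_zero]
  split_ifs with h
  · rw [Nat.choose_symm (Nat.lt_succ_iff.mp h)]
  · rw [Nat.choose_eq_zero_of_lt (by omega)]; simp

theorem ode (n : ℕ) :
    X * derivative (derivative (poly 0 n)) =
      (X - 1) * derivative (poly 0 n) - C (n : ℝ) * poly 0 n := by
  have key (k : ℕ) : ((k : ℝ) + 1) ^ 2 * (poly 0 n).coeff (k + 1) =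
      (k - n) * (poly 0 n).coeff k := by
    have h : (n.choose (k + 1) : ℝ) * (k + 1) = n.choose k * (n - k) := by
      rcases le_or_gt k n with hk | hk
      · have := Nat.choose_succ_right_eq n k
        rw [← Nat.cast_sub hk]
        exact_mod_cast this
      · simp [Nat.choose_eq_zero_of_lt hk, Nat.choose_eq_zero_of_lt (hk.trans k.lt_succ_self)]
    have := Nat.factorial_ne_zero k
    rw [coeff_poly_zero, coeff_poly_zero, Nat.factorial_succ, pow_succ]
    push_cast
    field_simp
    linear_combination -(-1) ^ k * h
  ext k
  rw [sub_mul, one_mul, coeff_sub, coeff_sub, coeff_C_mul]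
  cases k with
  | zero =>
    have := key 0
    simp [coeff_derivative, mul_coeff_zero] at this ⊢
    linarith
  | succ k =>
    have := key (k + 1)
    simp [coeff_derivative, coeff_X_mul] at this ⊢
    linear_combination this

theorem poly_zero_succ (n : ℕ) :
    C ((n : ℝ) + 1) * poly 0 (n + 1) =
      C ((n : ℝ) + 1) * poly 0 n + X * (derivative (poly 0 n) - poly 0 n) := by
  ext k
  cases k with
  | zero => simp [coeff_poly_zero, mul_coeff_zero]
  | succ k =>
    have h : ((k : ℝ) + 1) * n.choose (k + 1) = (n - k) * n.choose k := by
      rcases le_or_gt k n with hk | hk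
      · have := Nat.choose_succ_right_eq n k
        rw [← Nat.cast_sub hk, mul_comm, mul_comm _ (n.choose k : ℝ)]
        exact_mod_cast this
      · simp [Nat.choose_eq_zero_of_lt hk, Nat.choose_eq_zero_of_lt (hk.trans k.lt_succ_self)]
    have := Nat.factorial_ne_zero k
    rw [coeff_add, coeff_C_mul, coeff_C_mul, coeff_X_mul, coeff_sub, coeff_derivative,
      coeff_poly_zero, coeff_poly_zero, coeff_poly_zero, Nat.factorial_succ, pow_succ,
      Nat.choose_succ_succ]
    push_cast
    field_simp
    linear_combination h

theorem expMoment_poly_zero_sq (n : ℕ) : expMoment (poly 0 n ^ 2) = 1 := by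
  induction n with
  | zero =>
    have : poly 0 0 ^ 2 = monomial 0 1 := by simp [poly]
    rw [this, expMoment.monomial]
    simp
  | succ n ih =>
    have hA0 := expMoment.X_pow_mul_sq (poly 0 n) 0
    have hA1 := expMoment.X_pow_mul_sq (poly 0 n) 1
    have hB1 := expMoment.X_pow_mul_derivative_sq (ode n) 1
    have hC1 := expMoment.X_pow_mul_mul_derivative (ode n) 1
    have e := congrArg expMoment (congrArg (· ^ 2) (poly_zero_succ n))
    beta_reduce at e
    set y := poly 0 n
    have e1 : (C ((n : ℝ) + 1) * poly 0 (n + 1)) ^ 2 =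
        C (((n : ℝ) + 1) ^ 2) * poly 0 (n + 1) ^ 2 := by rw [mul_pow, C_pow]
    have e2 : (C ((n : ℝ) + 1) * y + X * (derivative y - y)) ^ 2 =
        C (((n : ℝ) + 1) ^ 2) * (X ^ 0 * y ^ 2) +
          (C (2 * ((n : ℝ) + 1)) * (X ^ 1 * (y * derivative y) - X ^ 1 * y ^ 2) +
          (X ^ 2 * derivative y ^ 2 - C 2 * (X ^ 2 * (y * derivative y)) + X ^ 2 * y ^ 2)) := by
      simp only [C_mul, C_pow, C_ofNat]
      ring
    rw [e1, e2] at e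
    simp only [map_add, map_sub, expMoment.C_mul] at e
    norm_num [ih] at hA0 hA1 hB1 hC1 e
    refine mul_left_cancel₀ (by positivity : ((n : ℝ) + 1) ^ 2 ≠ 0) ?_
    linear_combination e + hA1 - hC1 - 2 * n * hA0 + 2 * (hB1 + hC1 + n * hA0)

theorem expMoment_integrand (n : ℕ) :
    expMoment ((-(poly 0 n * derivative (poly 0 n)) -
      X * poly 0 n * derivative (derivative (poly 0 n)) +
      X * derivative (poly 0 n) ^ 2) * X ^ 2) = 2 * n ^ 3 := by
  have hnorm := expMoment_poly_zero_sq n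
  have hA := expMoment.X_pow_mul_sq (poly 0 n)
  have hB := expMoment.X_pow_mul_derivative_sq (ode n)
  have hC := expMoment.X_pow_mul_mul_derivative (ode n)
  have hA0 := hA 0
  have hA1 := hA 1
  have hA2 := hA 2
  have hB1 := hB 1
  have hB2 := hB 2
  have hB3 := hB 3
  have hC1 := hC 1
  have hC2 := hC 2
  have hC3 := hC 3
  clear hA hB hC
  have hode := ode n
  set y := poly 0 n
  have e : (-(y * derivative y) - X * y * derivative (derivative y) +
      X * derivative y ^ 2) * X ^ 2 =
      C (n : ℝ) * (X ^ 2 * y ^ 2) - X ^ 3 * (y * derivative y) + X ^ 3 * derivative y ^ 2 := by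
    linear_combination (-y * X ^ 2) * hode
  rw [e, map_add, map_sub, expMoment.C_mul]
  norm_num [hnorm] at hA0 hA1 hA2 hB1 hB2 hB3 hC1 hC2 hC3
  have b1 : expMoment (X * (y * derivative y)) = n := by
    linear_combination hB1 + hC1 + n * hA0
  have b2 : expMoment (X ^ 2 * (y * derivative y)) = 3 * n ^ 2 + n := by
    linear_combination (hB2 + hC2 + n * hA1 - hC1 + 2 * n * hA0 + 6 * n * b1) / 2
  have c3 : expMoment (X ^ 3 * derivative y ^ 2) = 6 * n ^ 3 := by
    linear_combination -hC2 + hC1 + 2 * n * b2 - 2 * n * b1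
  linear_combination -(hB3 + hC3 + n * hA2) / 3 + c3 / 3

end laguerreL

/-- The radial distribution function of the `n`-th bound-state projection of the hydrogen atom
integrates to `n²`; for `n = 1` the term `L_{n-2}^2 = L_{-1}^2` is interpreted as `0`. -/
theorem laguerre_integral_identity (n : ℕ) (hn : 1 ≤ n) :
    ∫ r in Set.Ioi (0 : ℝ),
        Real.exp (-r) *
          (laguerreL 0 n r * laguerreL 1 (n - 1) r -
            r * laguerreL 0 n r * (if 2 ≤ n then laguerreL 2 (n - 2) r else 0) +
            r * (laguerreL 1 (n - 1) r) ^ 2) * r ^ 2 =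
      2 * (n : ℝ) ^ 3 := by
  have h0 (r : ℝ) : laguerreL 0 n r = (laguerreL.poly 0 n).eval r :=
    (laguerreL.eval_poly 0 n r).symm
  have h1 : laguerreL.poly 1 (n - 1) = -Polynomial.derivative (laguerreL.poly 0 n) := by
    obtain ⟨m, rfl⟩ := Nat.exists_eq_add_of_le' hn
    rw [laguerreL.derivative_poly_succ, neg_neg, Nat.add_sub_cancel]
  have h2 (r : ℝ) : (if 2 ≤ n then laguerreL 2 (n - 2) r else 0) =
      (Polynomial.derivative (Polynomial.derivative (laguerreL.poly 0 n))).eval r := by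
    split_ifs with h
    · obtain ⟨m, rfl⟩ := Nat.exists_eq_add_of_le' h
      rw [laguerreL.derivative_poly_succ, Polynomial.derivative_neg,
        laguerreL.derivative_poly_succ, neg_neg, laguerreL.eval_poly, Nat.add_sub_cancel]
    · obtain rfl : n = 1 := by omega
      simp [laguerreL.derivative_poly_succ, laguerreL.derivative_poly_zero]
  rw [← laguerreL.expMoment_integrand n, ← (expMoment.integrableOn_and_integral_eq _).2]
  refine setIntegral_congr_fun measurableSet_Ioi fun r _ => ?_
  simp only [h0, h2, ← laguerreL.eval_poly 1, h1, Polynomial.eval_mul, Polynomial.eval_add,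
    Polynomial.eval_sub, Polynomial.eval_neg, Polynomial.eval_pow, Polynomial.eval_X]
  ring
end
end
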